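/- arXiv:1805.06322 — 5 statements merged into one kernel-verified Lean document; each statement's English description precedes it below -/
import Mathlib

section
/- Let Y ⊆ ℝ^m be a nonempty compact set and let L : ℝ^n × ℝ^m → ℝ be continuous, such that for every y ∈ Y the map x ↦ L(x,y) is differentiable and the gradient map (x,y) ↦ ∇ₓL(x,y) is continuous. Define φ(x) = max_{y ∈ Y} L(x,y). Fix x ∈ ℝ^n and suppose y* ∈ Y is the unique maximizer of y ↦ L(x,y) over Y, and that ∇ₓL(x,y*) ≠ 0. Then d = −∇ₓL(x,y*) is a descent direction for φ at x: there exists δ > 0 such that φ(x + t d) < φ(x) for all t ∈ (0, δ). -/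
open MeasureTheory Filter Set

/-- If `y*` is the unique maximizer of `y ↦ L(x,y)` over the nonempty compact set `Y`
and `∇ₓL(x,y*) ≠ 0`, then `d = −∇ₓL(x,y*)` is a descent direction for
`φ(x) = max_{y ∈ Y} L(x,y)` at `x`: there is `δ > 0` with `φ(x + t d) < φ(x)` for all
`t ∈ (0, δ)`. -/
theorem neg_gradient_descent_direction {n m : ℕ}
    (Y : Set (EuclideanSpace ℝ (Fin m))) (hne : Y.Nonempty) (hcomp : IsCompact Y)
    (L : EuclideanSpace ℝ (Fin n) → EuclideanSpace ℝ (Fin m) → ℝ)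
    (hcont : Continuous fun p : EuclideanSpace ℝ (Fin n) × EuclideanSpace ℝ (Fin m) =>
      L p.1 p.2)
    (hdiff : ∀ y ∈ Y, Differentiable ℝ fun x' => L x' y)
    (hgradcont : Continuous fun p : EuclideanSpace ℝ (Fin n) × EuclideanSpace ℝ (Fin m) =>
      gradient (fun x' => L x' p.2) p.1)
    (x : EuclideanSpace ℝ (Fin n)) (ystar : EuclideanSpace ℝ (Fin m)) (hyY : ystar ∈ Y)
    (hmax : ∀ y ∈ Y, L x y ≤ L x ystar)
    (huniq : ∀ y ∈ Y, L x y = L x ystar → y = ystar)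
    (hgrad : gradient (fun x' => L x' ystar) x ≠ 0) :
    ∃ δ > (0 : ℝ), ∀ t ∈ Set.Ioo (0 : ℝ) δ,
      sSup ((fun y => L (x + t • (-(gradient (fun x' => L x' ystar) x))) y) '' Y) <
        sSup ((fun y => L x y) '' Y) := by
  set d := -(gradient (fun x' => L x' ystar) x) with hd
  have hM : sSup ((fun y => L x y) '' Y) = L x ystar := by
    apply IsGreatest.csSup_eq
    refine ⟨⟨ystar, hyY, rfl⟩, ?_⟩
    rintro _ ⟨y, hy, rfl⟩
    exact hmax y hy
  have key : ∀ᶠ t in nhds (0 : ℝ), ∀ y ∈ Y, (0 < t → y ∈ Y → L (x + t • d) y < L x ystar) := by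
    apply hcomp.eventually_forall_of_forall_eventually
    intro y hy
    by_cases hys : y = ystar
    · subst hys
      have hc : Continuous fun z : ℝ × EuclideanSpace ℝ (Fin m) =>
          inner ℝ (gradient (fun x' => L x' z.2) (x + z.1 • d)) d :=
        (hgradcont.comp (by fun_prop :
          Continuous fun z : ℝ × EuclideanSpace ℝ (Fin m) => (x + z.1 • d, z.2))).inner
          continuous_const
      have h0 : inner ℝ (gradient (fun x' => L x' y) (x + (0 : ℝ) • d)) d < 0 := by
        rw [zero_smul, add_zero, hd, inner_neg_right, neg_lt_zero]
        exact real_inner_self_pos.2 hgrad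
      have hev : ∀ᶠ z : ℝ × EuclideanSpace ℝ (Fin m) in nhds ((0 : ℝ), y),
          inner ℝ (gradient (fun x' => L x' z.2) (x + z.1 • d)) d < 0 :=
        (isOpen_lt hc continuous_const).mem_nhds h0
      rw [nhds_prod_eq] at hev ⊢
      obtain ⟨pa, ha, pb, hb, hab⟩ := Filter.eventually_prod_iff.1 hev
      obtain ⟨ε, hε, hball⟩ := Metric.eventually_nhds_iff.1 ha
      have ha' : ∀ᶠ t in nhds (0 : ℝ), t < ε := eventually_lt_nhds hε
      refine Filter.eventually_prod_iff.2 ⟨_, ha', _, hb, ?_⟩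
      intro t ht y' hy' htpos hyY'
      have hder : ∀ s : ℝ, HasDerivAt (fun s : ℝ => L (x + s • d) y')
          (inner ℝ (gradient (fun x' => L x' y') (x + s • d)) d) s := by
        intro s
        have h1 := ((hdiff y' hyY') (x + s • d)).hasGradientAt.hasFDerivAt
        have h2 : HasDerivAt (fun s : ℝ => x + s • d) d s := by
          simpa using ((hasDerivAt_id s).smul_const d).const_add x
        have h3 := h1.comp_hasDerivAt s h2
        simpa [Function.comp_def] using h3
      obtain ⟨c, hc1, hc2⟩ := exists_hasDerivAt_eq_slope (fun s : ℝ => L (x + s • d) y') _ htpos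
        (fun s _ => (hder s).continuousAt.continuousWithinAt) (fun s _ => hder s)
      have hneg := hab (x := c) (hball (by
        rw [Real.dist_eq, sub_zero, abs_of_pos hc1.1]; exact hc1.2.trans ht)) hy'
      simp only at hneg
      rw [hc2, sub_zero, div_lt_iff₀ htpos, zero_mul, zero_smul, add_zero] at hneg
      have := hmax y' hyY'
      linarith
    · have hlt : L x y < L x ystar := lt_of_le_of_ne (hmax y hy) fun h => hys (huniq y hy h)
      have hc : Continuous fun z : ℝ × EuclideanSpace ℝ (Fin m) => L (x + z.1 • d) z.2 :=
        hcont.comp (by fun_prop :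
          Continuous fun z : ℝ × EuclideanSpace ℝ (Fin m) => (x + z.1 • d, z.2))
      have h0 : L (x + (0 : ℝ) • d) y < L x ystar := by
        rw [zero_smul, add_zero]; exact hlt
      have hev : ∀ᶠ z : ℝ × EuclideanSpace ℝ (Fin m) in nhds ((0 : ℝ), y),
          L (x + z.1 • d) z.2 < L x ystar :=
        (isOpen_lt hc continuous_const).mem_nhds h0
      filter_upwards [hev] with z hz _ _ using hz
  obtain ⟨δ, hδ, hball⟩ := Metric.eventually_nhds_iff.1 key
  refine ⟨δ, hδ, fun t ht => ?_⟩
  rw [hM]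
  have hc : Continuous fun y => L (x + t • d) y :=
    hcont.comp (by fun_prop : Continuous fun y : EuclideanSpace ℝ (Fin m) => (x + t • d, y))
  obtain ⟨y, hy, hyeq⟩ := hcomp.exists_sSup_image_eq hne hc.continuousOn
  rw [hyeq]
  exact hball (by rw [Real.dist_eq, sub_zero, abs_of_pos ht.1]; exact ht.2) y hy ht.1 hy
end

section
/- Let f : ℝ → ℝ be twice differentiable with |f″(t)| ≤ M for all t ∈ ℝ, let x ∈ ℝ and σ > 0, and let ε be distributed according to the standard Gaussian measure γ on ℝ (mean 0, variance 1). Then the function ε ↦ f(x + σε)·ε is γ-integrable and |∫ f(x + σε)·ε dγ(ε) − σ·f′(x)| ≤ (M/2)·σ²·E_γ[|ε|³], where E_γ[|ε|³] = 2√(2/π). -/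
open MeasureTheory ProbabilityTheory

lemma gs_taylor (f : ℝ → ℝ) (M x d : ℝ) 
    (hf : Differentiable ℝ f) (hf' : Differentiable ℝ (deriv f))
    (hM : ∀ t, |deriv (deriv f) t| ≤ M) :
    |f (x + d) - f x - d * deriv f x| ≤ M / 2 * d ^ 2 := by
  have hlip : ∀ y, |deriv f y - deriv f x| ≤ M * |y - x| := fun y => by
    have := Convex.norm_image_sub_le_of_norm_deriv_le (f := deriv f) (s := Set.univ) (C := M)
      (fun z _ => hf' z) (fun z _ => hM z) convex_univ (Set.mem_univ x) (Set.mem_univ y)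
    simpa using this
  have hd : ∀ t : ℝ, HasDerivAt (fun t : ℝ => f (x + t * d) - f x - t * d * deriv f x)
      (deriv f (x + t * d) * d - d * deriv f x) t := fun t => by
    have h1 : HasDerivAt (fun t : ℝ => x + t * d) d t := by
      simpa using ((hasDerivAt_id t).mul_const d).const_add x
    have h2 := (hf (x + t * d)).hasDerivAt.comp t h1
    have h3 : HasDerivAt (fun t : ℝ => t * d * deriv f x) (d * deriv f x) t := by
      simpa using ((hasDerivAt_id t).mul_const d).mul_const (deriv f x)
    exact (h2.sub_const (f x)).sub h3
  have hB : ∀ t : ℝ, HasDerivAt (fun t : ℝ => M / 2 * d ^ 2 * t ^ 2) (M * d ^ 2 * t) t := fun t => by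
    have := (hasDerivAt_pow 2 t).const_mul (M / 2 * d ^ 2)
    convert! this using 1
    simp; ring
  have := image_norm_le_of_norm_deriv_right_le_deriv_boundary (a := 0) (b := 1)
    (f := fun t : ℝ => f (x + t * d) - f x - t * d * deriv f x)
    (fun t _ => (hd t).continuousAt.continuousWithinAt) (fun t _ => (hd t).hasDerivWithinAt)
    (B := fun t : ℝ => M / 2 * d ^ 2 * t ^ 2) (by simp) hB
    (fun t ht => by
      have h := hlip (x + t * d)
      rw [show x + t * d - x = t * d by ring, abs_mul, abs_of_nonneg ht.1] at h
      rw [Real.norm_eq_abs, show deriv f (x + t * d) * d - d * deriv f x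
        = (deriv f (x + t * d) - deriv f x) * d by ring, abs_mul, ← sq_abs d]
      nlinarith [abs_nonneg d])
    (x := 1) (by simp)
  simpa using this

lemma gs_third : (∫ ε, |ε| ^ 3 ∂(gaussianReal 0 1)) = 2 * Real.sqrt (2 / Real.pi) := by
  rw [integral_gaussianReal_eq_integral_smul one_ne_zero]
  have h1 : ∀ ε : ℝ, gaussianPDFReal 0 1 ε • |ε| ^ 3 =
      (fun y : ℝ => (√(2 * Real.pi))⁻¹ * (y ^ (3:ℝ) * Real.exp (-(1/2) * y ^ (2:ℝ)))) |ε| := by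
    intro ε
    simp only [gaussianPDFReal, smul_eq_mul]
    have e3 : |ε| ^ (3:ℝ) = |ε| ^ 3 := by exact_mod_cast Real.rpow_natCast |ε| 3
    have e2 : |ε| ^ (2:ℝ) = ε ^ 2 := by
      rw [← sq_abs]; exact_mod_cast Real.rpow_natCast |ε| 2
    rw [e3, e2]
    simp
    ring_nf
  simp_rw [h1]
  rw [integral_comp_abs (f := fun y : ℝ => (√(2 * Real.pi))⁻¹ * (y ^ (3:ℝ) * Real.exp (-(1/2) * y ^ (2:ℝ)))),
    integral_const_mul, integral_rpow_mul_exp_neg_mul_rpow (by norm_num) (by norm_num) (by norm_num)]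
  have hG : Real.Gamma ((3 + 1) / 2) = 1 := by norm_num
  have hp : ((1:ℝ) / 2) ^ (-(3 + 1) / 2 : ℝ) = 4 := by
    rw [show (-(3 + 1) / 2 : ℝ) = -((2:ℕ):ℝ) by norm_num, Real.rpow_neg (by norm_num),
      Real.rpow_natCast]
    norm_num
  rw [hG, hp, Real.sqrt_div (by norm_num), Real.sqrt_mul (by norm_num)]
  have := Real.sq_sqrt (show (0:ℝ) ≤ 2 by norm_num)
  have h2 : √Real.pi ≠ 0 := by positivity
  field_simp
  linarith

/-- If `f : ℝ → ℝ` is twice differentiable with `|f''| ≤ M` everywhere, `x ∈ ℝ`, `σ > 0`,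
and `γ` is the standard Gaussian measure, then `ε ↦ f(x + σε) ε` is `γ`-integrable and
`|∫ f(x + σε) ε dγ(ε) − σ f'(x)| ≤ (M/2) σ² E_γ[|ε|³]`, where `E_γ[|ε|³] = 2√(2/π)`. -/
theorem gaussian_smoothing_second_order_bound (f : ℝ → ℝ) (M x σ : ℝ) (hσ : 0 < σ)
    (hf : Differentiable ℝ f) (hf' : Differentiable ℝ (deriv f))
    (hM : ∀ t, |deriv (deriv f) t| ≤ M) :
    Integrable (fun ε => f (x + σ * ε) * ε) (gaussianReal 0 1) ∧
    (∫ ε, |ε| ^ 3 ∂(gaussianReal 0 1)) = 2 * Real.sqrt (2 / Real.pi) ∧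
    |(∫ ε, f (x + σ * ε) * ε ∂(gaussianReal 0 1)) - σ * deriv f x| ≤
      M / 2 * σ ^ 2 * (2 * Real.sqrt (2 / Real.pi)) := by
  have i1 : Integrable (fun ε : ℝ => ε) (gaussianReal 0 1) :=
    (memLp_id_gaussianReal 1).integrable (by simp)
  have i2 : Integrable (fun ε : ℝ => ε ^ 2) (gaussianReal 0 1) :=
    (memLp_id_gaussianReal 2).integrable_sq
  have i3 : Integrable (fun ε : ℝ => |ε| ^ 3) (gaussianReal 0 1) :=
    (memLp_id_gaussianReal (μ := 0) (v := 1) 3).integrable_norm_pow (p := 3) (by norm_num)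
  have v2 : ∫ ε, ε ^ 2 ∂(gaussianReal 0 1) = 1 := by
    have h := variance_id_gaussianReal (μ := 0) (v := 1)
    rw [variance_of_integral_eq_zero (by fun_prop) (by simp)] at h
    simpa using h
  have hc := hf.continuous
  have hb : ∀ ε : ℝ, ‖(f (x + σ * ε) - f x - σ * ε * deriv f x) * ε‖ ≤ M / 2 * σ ^ 2 * |ε| ^ 3 := by
    intro ε
    have := gs_taylor f M x (σ * ε) hf hf' hM
    rw [Real.norm_eq_abs, abs_mul]
    calc _ ≤ M / 2 * (σ * ε) ^ 2 * |ε| := by gcongr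
      _ = _ := by rw [mul_pow, ← sq_abs ε]; ring
  have iR : Integrable (fun ε : ℝ => (f (x + σ * ε) - f x - σ * ε * deriv f x) * ε)
      (gaussianReal 0 1) :=
    (i3.const_mul (M / 2 * σ ^ 2)).mono' (by fun_prop) (.of_forall hb)
  have iL : Integrable (fun ε : ℝ => f x * ε + σ * deriv f x * ε ^ 2) (gaussianReal 0 1) :=
    (i1.const_mul _).add (i2.const_mul _)
  have heq : (fun ε => f (x + σ * ε) * ε) = fun ε : ℝ =>
      (f (x + σ * ε) - f x - σ * ε * deriv f x) * ε + (f x * ε + σ * deriv f x * ε ^ 2) := by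
    funext ε; ring
  refine ⟨heq ▸ iR.add iL, gs_third, ?_⟩
  rw [heq, integral_add iR iL, integral_add (i1.const_mul _) (i2.const_mul _),
    integral_const_mul, integral_const_mul, v2, integral_id_gaussianReal, ← gs_third,
    ← integral_const_mul]
  have := norm_integral_le_of_norm_le (i3.const_mul (M / 2 * σ ^ 2)) (.of_forall hb)
  rw [Real.norm_eq_abs] at this
  convert! this using 2
  ring
end

section
/- Let f : ℝ → ℝ be bounded and measurable and fix σ > 0. Then the smoothed objective J(μ) = ∫ f(x) dN(μ, σ²)(x), where N(μ, σ²) is the Gaussian measure on ℝ with mean μ and variance σ², is differentiable in μ, and its derivative satisfies J′(μ) = (1/σ)·∫ f(μ + σε)·ε dγ(ε), where γ is the standard Gaussian measure on ℝ (the log-likelihood/reparameterization identity underlying natural evolution strategies). -/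
open MeasureTheory ProbabilityTheory

lemma nes_shift (g : ℝ → ℝ) (h : ℝ) :
    ∫ x, g x ∂(gaussianReal h 1)
      = ∫ x, g x * Real.exp (h * x - h ^ 2 / 2) ∂(gaussianReal 0 1) := by
  rw [integral_gaussianReal_eq_integral_smul one_ne_zero,
    integral_gaussianReal_eq_integral_smul one_ne_zero]
  congr 1
  ext x
  have : gaussianPDFReal h 1 x = gaussianPDFReal 0 1 x * Real.exp (h * x - h ^ 2 / 2) := by
    simp only [gaussianPDFReal]
    rw [mul_assoc _ (Real.exp _) (Real.exp _), ← Real.exp_add]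
    congr 2
    simp
    ring
  rw [this, smul_eq_mul, smul_eq_mul]
  ring

lemma nes_map (f : ℝ → ℝ) (hmeas : Measurable f) (σ : ℝ) (μ h : ℝ) :
    ∫ x, f x ∂(gaussianReal (μ + σ * h) (σ ^ 2).toNNReal)
      = ∫ x, f (μ + σ * x) ∂(gaussianReal h 1) := by
  have e : gaussianReal (μ + σ * h) (σ ^ 2).toNNReal
      = (gaussianReal h 1).map (fun x => μ + σ * x) := by
    have h1 := gaussianReal_map_const_mul (μ := h) (v := 1) σ
    have h2 := gaussianReal_map_const_add (μ := σ * h) (v := (σ ^ 2).toNNReal) μ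
    have h3 : NNReal.mk (σ ^ 2) (sq_nonneg σ) * 1 = (σ ^ 2).toNNReal := by
      rw [mul_one, Real.toNNReal_of_nonneg (sq_nonneg σ)]
    rw [h3] at h1
    rw [← h1, Measure.map_map (by fun_prop) (by fun_prop)] at h2
    rw [add_comm μ, ← h2]
    rfl
  rw [e, integral_map (by fun_prop) hmeas.aestronglyMeasurable]

lemma nes_deriv (g : ℝ → ℝ) (hmeas : Measurable g) (C : ℝ) (hbd : ∀ t, |g t| ≤ C) :
    HasDerivAt (fun h : ℝ => ∫ x, g x * Real.exp (h * x - h ^ 2 / 2) ∂(gaussianReal 0 1))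
      (∫ x, g x * x ∂(gaussianReal 0 1)) 0 := by
  have hC : 0 ≤ C := (abs_nonneg _).trans (hbd 0)
  have key := hasDerivAt_integral_of_dominated_loc_of_deriv_le (μ := gaussianReal 0 1)
    (F := fun h x : ℝ => g x * Real.exp (h * x - h ^ 2 / 2))
    (F' := fun h x : ℝ => g x * (Real.exp (h * x - h ^ 2 / 2) * (x - h)))
    (x₀ := (0 : ℝ)) (s := Metric.ball 0 1)
    (bound := fun x => C * (Real.exp (2 * x) + Real.exp (-2 * x)))
    (Metric.ball_mem_nhds 0 one_pos)
    (Filter.Eventually.of_forall fun h => by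
      exact Measurable.aestronglyMeasurable (by fun_prop))
    (by
      refine Integrable.of_bound (Measurable.aestronglyMeasurable (by fun_prop)) C ?_
      exact Filter.Eventually.of_forall fun x => by simpa using hbd x)
    (Measurable.aestronglyMeasurable (by fun_prop))
    (Filter.Eventually.of_forall fun x h hh => by
      rw [Metric.mem_ball, dist_zero_right, Real.norm_eq_abs] at hh
      rw [Real.norm_eq_abs, abs_mul, abs_mul, Real.abs_exp]
      refine mul_le_mul (hbd x) ?_ (by positivity) hC
      have h1 : Real.exp (h * x - h ^ 2 / 2) ≤ Real.exp |x| := by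
        apply Real.exp_le_exp.2
        have : h * x ≤ |h| * |x| := by rw [← abs_mul]; exact le_abs_self _
        nlinarith [abs_nonneg x, sq_nonneg h]
      have h2 : |x - h| ≤ Real.exp |x| := by
        have := abs_sub x h
        linarith [Real.add_one_le_exp |x|]
      have h3 : Real.exp |x| * Real.exp |x| ≤ Real.exp (2 * x) + Real.exp (-2 * x) := by
        rw [← Real.exp_add]
        rcases abs_cases x with ⟨h, _⟩ | ⟨h, _⟩ <;> rw [h]
        · rw [← two_mul]; linarith [Real.exp_pos (-2 * x)]
        · rw [show -x + -x = -2 * x by ring]; linarith [Real.exp_pos (2 * x)]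
      exact (mul_le_mul h1 h2 (abs_nonneg _) (Real.exp_pos _).le).trans h3)
    (((integrable_exp_mul_gaussianReal 2).add (integrable_exp_mul_gaussianReal (-2))).const_mul C)
    (Filter.Eventually.of_forall fun x h _ => by
      have h1 : HasDerivAt (fun h : ℝ => h * x - h ^ 2 / 2) (x - h) h := by
        have := ((hasDerivAt_id h).mul_const x).sub (((hasDerivAt_id h).pow 2).div_const 2)
        refine this.congr_deriv ?_
        simp
      exact h1.exp.const_mul (g x))
  simpa using key.2

/-- **Log-likelihood / reparameterization identity of natural evolution strategies.**
For bounded measurable `f : ℝ → ℝ` and fixed `σ > 0`, the smoothed objective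
`J(μ) = ∫ f dN(μ, σ²)` is differentiable in `μ` with
`J'(μ) = (1/σ) ∫ f(μ + σε) ε dγ(ε)`, `γ` the standard Gaussian measure. -/
theorem nes_loglikelihood_gradient (f : ℝ → ℝ) (hmeas : Measurable f)
    (C : ℝ) (hbd : ∀ t, |f t| ≤ C) (σ : ℝ) (hσ : 0 < σ) (μ : ℝ) :
    HasDerivAt (fun μ' : ℝ => ∫ x, f x ∂(gaussianReal μ' (σ ^ 2).toNNReal))
      ((1 / σ) * ∫ ε, f (μ + σ * ε) * ε ∂(gaussianReal 0 1)) μ := by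
  have hd := nes_deriv (fun x => f (μ + σ * x)) (by fun_prop) C (fun t => hbd _)
  have hl : HasDerivAt (fun m : ℝ => (m - μ) / σ) (1 / σ) μ :=
    ((hasDerivAt_id μ).sub_const μ).div_const σ
  have hd' : HasDerivAt
      (fun h : ℝ => ∫ x, f (μ + σ * x) * Real.exp (h * x - h ^ 2 / 2) ∂(gaussianReal 0 1))
      (∫ x, f (μ + σ * x) * x ∂(gaussianReal 0 1)) ((fun m : ℝ => (m - μ) / σ) μ) := by
    simpa using hd
  have hc := HasDerivAt.comp μ hd' hl
  rw [mul_comm]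
  refine hc.congr_of_eventuallyEq (Filter.Eventually.of_forall fun m => ?_)
  rw [Function.comp_apply, ← nes_shift (fun x => f (μ + σ * x)), ← nes_map f hmeas]
  have : μ + σ * ((m - μ) / σ) = m := by
    field_simp
    ring
  rw [this]
end

section
/- Define L₂ : ℝ³ × ℝ³ → ℝ by L₂(x, y) = Σ_{i=1}^{3} min{3 − 0.2·xᵢ + 0.3·yᵢ, 3 + 0.2·xᵢ − 0.1·yᵢ} on [0,10]³ × [0,10]³. Then the maximin value satisfies max_{y ∈ [0,10]³} min_{x ∈ [0,10]³} L₂(x, y) = 7.5, attained at y = (5,5,5); in particular max_{y} min_{x} L₂ = 7.5 < 9 = min_{x} max_{y} L₂, so L₂ admits no saddle point on [0,10]³ × [0,10]³ (the problem is asymmetrical). -/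
/-- The benchmark function
`L₂(x,y) = Σ_{i=1}^{3} min{3 − 0.2 xᵢ + 0.3 yᵢ, 3 + 0.2 xᵢ − 0.1 yᵢ}`. -/
noncomputable def L2 (x y : Fin 3 → ℝ) : ℝ :=
  ∑ i, min (3 - 0.2 * x i + 0.3 * y i) (3 + 0.2 * x i - 0.1 * y i)

/-- The box `[0,10]³`. -/
def box3 : Set (Fin 3 → ℝ) := {z | ∀ i, z i ∈ Set.Icc (0 : ℝ) 10}

lemma L2_bddBelow (y : Fin 3 → ℝ) (hy : y ∈ box3) :
    BddBelow ((fun x => L2 x y) '' box3) := by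
  refine ⟨0, ?_⟩
  rintro _ ⟨x, hx, rfl⟩
  refine Finset.sum_nonneg fun i _ => ?_
  have h1 := hx i
  have h2 := hy i
  simp only [Set.mem_Icc] at h1 h2
  refine le_min ?_ ?_ <;> norm_num <;> linarith

lemma L2_bddAbove (x : Fin 3 → ℝ) (hx : x ∈ box3) :
    BddAbove ((fun y => L2 x y) '' box3) := by
  refine ⟨∑ _i : Fin 3, 6, ?_⟩
  rintro _ ⟨y, hy, rfl⟩
  refine Finset.sum_le_sum fun i _ => ?_
  have h1 := hx i
  have h2 := hy i
  simp only [Set.mem_Icc] at h1 h2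
  refine (min_le_left _ _).trans ?_
  norm_num
  linarith

lemma L2_low (y : Fin 3 → ℝ) : ∃ x ∈ box3, L2 x y ≤ 7.5 := by
  refine ⟨fun i => if 5 ≤ y i then 0 else 10, ?_, ?_⟩
  · intro i
    dsimp only
    split_ifs <;> constructor <;> norm_num
  · have : (7.5 : ℝ) = ∑ _i : Fin 3, 2.5 := by norm_num
    rw [this]
    refine Finset.sum_le_sum fun i _ => ?_
    dsimp only
    split_ifs with h
    · refine (min_le_right _ _).trans ?_
      norm_num
      linarith
    · refine (min_le_left _ _).trans ?_
      norm_num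
      linarith

lemma L2_diag (x : Fin 3 → ℝ) (hx : x ∈ box3) : 9 ≤ L2 x x := by
  have : (9 : ℝ) = ∑ _i : Fin 3, 3 := by norm_num
  rw [this]
  refine Finset.sum_le_sum fun i _ => ?_
  have h1 := hx i
  simp only [Set.mem_Icc] at h1
  refine le_min ?_ ?_ <;> norm_num <;> linarith

lemma L2_five (x : Fin 3 → ℝ) (hx : x ∈ box3) : 7.5 ≤ L2 x (fun _ => 5) := by
  have : (7.5 : ℝ) = ∑ _i : Fin 3, 2.5 := by norm_num
  rw [this]
  refine Finset.sum_le_sum fun i _ => ?_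
  have h1 := hx i
  simp only [Set.mem_Icc] at h1
  refine le_min ?_ ?_ <;> norm_num <;> linarith

lemma L2_zero (y : Fin 3 → ℝ) (hy : y ∈ box3) : L2 (fun _ => 0) y ≤ 9 := by
  have : (9 : ℝ) = ∑ _i : Fin 3, 3 := by norm_num
  rw [this]
  refine Finset.sum_le_sum fun i _ => ?_
  have h1 := hy i
  simp only [Set.mem_Icc] at h1
  refine (min_le_right _ _).trans ?_
  norm_num
  linarith

lemma const_mem_box3 (c : ℝ) (h0 : 0 ≤ c) (h1 : c ≤ 10) : (fun _ => c) ∈ box3 :=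
  fun _ => ⟨h0, h1⟩

lemma L2_sInf_le (y : Fin 3 → ℝ) (hy : y ∈ box3) :
    sInf ((fun x => L2 x y) '' box3) ≤ 7.5 := by
  obtain ⟨x, hx, h⟩ := L2_low y
  exact (csInf_le (L2_bddBelow y hy) ⟨x, hx, rfl⟩).trans h

lemma L2_le_sSup (x : Fin 3 → ℝ) (hx : x ∈ box3) :
    9 ≤ sSup ((fun y => L2 x y) '' box3) :=
  (L2_diag x hx).trans (le_csSup (L2_bddAbove x hx) ⟨x, hx, rfl⟩)

/-- The maximin value of `L₂` over `[0,10]³ × [0,10]³` is `7.5`, attained at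
`y = (5,5,5)`; in particular `max_y min_x L₂ = 7.5 < 9 = min_x max_y L₂`, so `L₂` has no
saddle point on `[0,10]³ × [0,10]³` (the problem is asymmetrical). -/
theorem L2_maximin_and_no_saddle :
    -- `max_y min_x L₂ = 7.5`, attained:
    IsGreatest ((fun y => sInf ((fun x => L2 x y) '' box3)) '' box3) 7.5 ∧
    -- it is attained at `y = (5,5,5)`:
    sInf ((fun x => L2 x (fun _ => 5)) '' box3) = 7.5 ∧
    -- `min_x max_y L₂ = 9`, attained:
    IsLeast ((fun x => sSup ((fun y => L2 x y) '' box3)) '' box3) 9 ∧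
    -- `7.5 < 9`:
    (7.5 : ℝ) < 9 ∧
    -- hence there is no saddle point:
    ¬ ∃ xh ∈ box3, ∃ yh ∈ box3, ∀ x ∈ box3, ∀ y ∈ box3,
        L2 xh y ≤ L2 xh yh ∧ L2 xh yh ≤ L2 x yh := by
  have m5 := const_mem_box3 5 (by norm_num) (by norm_num)
  have m0 := const_mem_box3 0 (by norm_num) (by norm_num)
  have h5 : sInf ((fun x => L2 x (fun _ => 5)) '' box3) = 7.5 := by
    refine le_antisymm (L2_sInf_le _ m5) (le_csInf ⟨_, _, m5, rfl⟩ ?_)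
    rintro _ ⟨x, hx, rfl⟩
    exact L2_five x hx
  have h0 : sSup ((fun y => L2 (fun _ => 0) y) '' box3) = 9 := by
    refine le_antisymm (csSup_le ⟨_, _, m5, rfl⟩ ?_) (L2_le_sSup _ m0)
    rintro _ ⟨y, hy, rfl⟩
    exact L2_zero y hy
  refine ⟨⟨⟨_, m5, h5⟩, ?_⟩, h5, ⟨⟨_, m0, h0⟩, ?_⟩, by norm_num, ?_⟩
  · rintro _ ⟨y, hy, rfl⟩
    exact L2_sInf_le y hy
  · rintro _ ⟨x, hx, rfl⟩
    exact L2_le_sSup x hx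
  · rintro ⟨xh, hx, yh, hy, h⟩
    obtain ⟨x, hx', hl⟩ := L2_low yh
    have h1 := (h x hx' xh hx).1
    have h2 := (h x hx' xh hx).2
    have h3 := L2_diag xh hx
    norm_num at hl
    linarith
end

section
/- Define L₅ : ℝ² × ℝ² → ℝ by L₅(x, y) = 100·(x₂ − x₁²)² + (1 − x₁)² − y₁·(x₁ + x₂²) − y₂·(x₁² + x₂), with 𝒳 = [−0.5, 0.5] × [0, 1] and 𝒴 = [0, 10]². Then the minimax value satisfies min_{x ∈ 𝒳} max_{y ∈ 𝒴} L₅(x, y) = 0.25, and the outer minimum is attained at x* = (0.5, 0.25), at which the inner maximum is attained at y* = (0, 0). -/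
/-- The benchmark function
`L₅(x,y) = 100 (x₂ − x₁²)² + (1 − x₁)² − y₁ (x₁ + x₂²) − y₂ (x₁² + x₂)`. -/
noncomputable def L5 (x y : ℝ × ℝ) : ℝ :=
  100 * (x.2 - x.1 ^ 2) ^ 2 + (1 - x.1) ^ 2 - y.1 * (x.1 + x.2 ^ 2) - y.2 * (x.1 ^ 2 + x.2)

/-- The domain `𝒳 = [−0.5, 0.5] × [0, 1]`. -/
def X5 : Set (ℝ × ℝ) := Set.Icc (-0.5 : ℝ) 0.5 ×ˢ Set.Icc (0 : ℝ) 1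

/-- The domain `𝒴 = [0, 10]²`. -/
def Y5 : Set (ℝ × ℝ) := Set.Icc (0 : ℝ) 10 ×ˢ Set.Icc (0 : ℝ) 10

/-- The minimax value of `L₅` over `𝒳 × 𝒴` is `0.25`: the outer minimum of
`x ↦ max_{y ∈ 𝒴} L₅(x,y)` is attained at `x* = (0.5, 0.25)`, where the inner maximum
equals `0.25` and is attained at `y* = (0, 0)`. -/
theorem L5_minimax_value :
    -- `min_x max_y L₅ = 0.25`, attained:
    IsLeast ((fun x => sSup ((fun y => L5 x y) '' Y5)) '' X5) 0.25 ∧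
    -- the inner maximum at `x* = (0.5, 0.25)` equals `0.25` and is attained:
    IsGreatest ((fun y => L5 (0.5, 0.25) y) '' Y5) 0.25 ∧
    -- it is attained at `y* = (0, 0)`:
    L5 (0.5, 0.25) (0, 0) = 0.25 := by
  have hG : IsGreatest ((fun y => L5 (0.5, 0.25) y) '' Y5) 0.25 := by
    refine ⟨⟨(0, 0), ?_, ?_⟩, ?_⟩
    · simp only [Y5, Set.mem_prod, Set.mem_Icc]; norm_num
    · simp only [L5]; norm_num
    · rintro _ ⟨⟨a, b⟩, hy, rfl⟩
      simp only [Y5, Set.mem_prod, Set.mem_Icc] at hy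
      obtain ⟨⟨h1, h2⟩, h3, h4⟩ := hy
      simp only [L5]
      norm_num
      linarith
  refine ⟨⟨⟨(0.5, 0.25), ?_, hG.csSup_eq⟩, ?_⟩, hG, ?_⟩
  · simp only [X5, Set.mem_prod, Set.mem_Icc]; norm_num
  · rintro _ ⟨⟨p, q⟩, hx, rfl⟩
    simp only [X5, Set.mem_prod, Set.mem_Icc] at hx
    obtain ⟨⟨h1, h2⟩, h3, h4⟩ := hx
    have hc : IsCompact Y5 := isCompact_Icc.prod isCompact_Icc
    have hf : Continuous (fun y : ℝ × ℝ => L5 (p, q) y) := by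
      unfold L5; fun_prop
    have hb : BddAbove ((fun y => L5 (p, q) y) '' Y5) := (hc.image hf).bddAbove
    have hm : L5 (p, q) (0, 0) ∈ (fun y => L5 (p, q) y) '' Y5 :=
      ⟨(0, 0), by simp only [Y5, Set.mem_prod, Set.mem_Icc]; norm_num, rfl⟩
    refine le_trans ?_ (le_csSup hb hm)
    simp only [L5]
    norm_num at h2 ⊢
    nlinarith [sq_nonneg (q - p ^ 2)]
  · simp only [L5]; norm_num
end
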